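/- arXiv:2112.09502 — 2 statements merged into one kernel-verified Lean document; each statement's English description precedes it below -/
import Mathlib

section
/- Let $f: C_1 \to C_2$ be a flat ring homomorphism of Noetherian commutative rings, and let $P$ be a prime ideal of $C_1$ such that $P C_2 \neq C_2$. Then $\operatorname{ht} P = \operatorname{ht}(P C_2)$, where $\operatorname{ht}(PC_2)$ denotes the height of the ideal $PC_2$ (the minimum of the heights of its minimal primes). -/
/-- The height of an ideal `I`: the infimum of `Order.height` of the primes containing `I`
(equivalently, the minimum of the heights of the minimal primes over `I`). -/
noncomputable def Ideal.ht {R : Type*} [CommRing R] (I : Ideal R) : ℕ∞ :=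
  ⨅ (P : PrimeSpectrum R) (_ : I ≤ P.asIdeal), Order.height P

theorem Ideal.ht_eq_height {R : Type*} [CommRing R] (I : Ideal R) : I.ht = I.height := by
  refine le_antisymm ?_ (le_iInf₂ fun Q hQ ↦ ?_)
  · rw [Ideal.height_eq_inf_minimalPrimes]
    refine le_iInf₂ fun J hJ ↦ ?_
    exact (iInf₂_le (⟨J, hJ.isPrime⟩ : PrimeSpectrum R) hJ.le).trans_eq
      (PrimeSpectrum.height_eq_orderHeight _).symm
  · rw [← PrimeSpectrum.height_eq_orderHeight]
    exact Ideal.height_mono hQ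

/-- Under going down, a minimal prime over the extension of a prime `P` contracts to `P`. -/
theorem Ideal.liesOver_of_mem_minimalPrimes_map {R S : Type*} [CommRing R] [CommRing S]
    [Algebra R S] [Algebra.HasGoingDown R S] (P : Ideal R) [P.IsPrime] {Q : Ideal S}
    (hQ : Q ∈ (P.map (algebraMap R S)).minimalPrimes) : Q.LiesOver P := by
  have := hQ.isPrime
  obtain ⟨Q', hle, hQ', hover⟩ :=
    Ideal.exists_ideal_le_liesOver_of_le (q := Q.under R) Q (Ideal.map_le_iff_le_comap.mp hQ.le)
  have hmap : P.map (algebraMap R S) ≤ Q' :=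
    Ideal.map_le_iff_le_comap.mpr (Q'.over_def P).le
  rwa [← hle.antisymm (hQ.2 ⟨hQ', hmap⟩ hle)]

theorem Ideal.height_map_quotientMk_of_mem_minimalPrimes {R : Type*} [CommRing R]
    {I Q : Ideal R} (hQ : Q ∈ I.minimalPrimes) : (Q.map (Ideal.Quotient.mk I)).height = 0 := by
  rw [Ideal.minimalPrimes_eq_comap] at hQ
  obtain ⟨q, hq, rfl⟩ := hQ
  rw [Ideal.map_comap_of_surjective _ Ideal.Quotient.mk_surjective]
  have : q.IsPrime := hq.isPrime
  exact Ideal.height_eq_zero_iff.mpr hq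

theorem Ideal.height_eq_of_mem_minimalPrimes_map {R S : Type*} [CommRing R] [CommRing S]
    [IsNoetherianRing R] [IsNoetherianRing S] [Algebra R S] [Algebra.HasGoingDown R S]
    (P : Ideal R) [P.IsPrime] {Q : Ideal S}
    (hQ : Q ∈ (P.map (algebraMap R S)).minimalPrimes) : Q.height = P.height := by
  have := hQ.isPrime
  have := P.liesOver_of_mem_minimalPrimes_map hQ
  rw [Ideal.height_eq_height_add_of_liesOver_of_hasGoingDown P Q,
    Ideal.height_map_quotientMk_of_mem_minimalPrimes hQ, add_zero]

/-- Let `f : C₁ → C₂` be a flat ring homomorphism of Noetherian rings and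
`P` a prime of `C₁` with `P C₂ ≠ C₂`.  Then `ht P = ht (P C₂)`. -/
theorem height_map_eq_of_flat
    {C₁ C₂ : Type*} [CommRing C₁] [CommRing C₂]
    [IsNoetherianRing C₁] [IsNoetherianRing C₂]
    [Algebra C₁ C₂] [Module.Flat C₁ C₂]
    (P : Ideal C₁) [P.IsPrime]
    (h : Ideal.map (algebraMap C₁ C₂) P ≠ ⊤) :
    P.ht = (Ideal.map (algebraMap C₁ C₂) P).ht := by
  rw [Ideal.ht_eq_height, Ideal.ht_eq_height,
    Ideal.height_eq_inf_minimalPrimes (P.map (algebraMap C₁ C₂))]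
  rw [biInf_congr fun Q hQ ↦ P.height_eq_of_mem_minimalPrimes_map hQ,
    biInf_const (Set.nonempty_coe_sort.mp (Ideal.nonempty_minimalPrimes h))]
end

section
/- Let $S = k[x_1,\ldots,x_N]((t))$ over a field $k$ of characteristic zero, and let $P$ be a prime ideal of $S_1 := k[x_1,\ldots,x_N][[t]]$ of height $r$ with $P \cap k[[t]] = (0)$ (equivalently $t \notin P$). Then the ideal $\mathcal{J}_r(P; \operatorname{Der}_{k[[t]]}(S_1))$ generated by the $r\times r$ determinants $\det(D_i(f_j))$ with $D_i \in \operatorname{Der}_{k[[t]]}(S_1)$, $f_j \in P$, is not contained in $P$. -/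
set_option synthInstance.maxHeartbeats 800000
set_option maxHeartbeats 1600000

/-- The `k[[t]]`-algebra structure on `S₁ = k[x₁,…,x_N][[t]]` given by mapping
coefficients. -/
noncomputable instance psAlgebra {k : Type*} [CommRing k] {N : ℕ} :
    Algebra (PowerSeries k) (PowerSeries (MvPolynomial (Fin N) k)) :=
  (PowerSeries.map (algebraMap k (MvPolynomial (Fin N) k))).toAlgebra

/-- The ideal `𝒥_r(P; Der_{k[[t]]}(S₁))` generated by the `r × r` determinants
`det (Dᵢ (fⱼ))` with `Dᵢ ∈ Der_{k[[t]]}(S₁)` and `fⱼ ∈ P`. -/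
noncomputable def derJacobianIdeal {k : Type*} [Field k] {N : ℕ} (r : ℕ)
    (P : Ideal (PowerSeries (MvPolynomial (Fin N) k))) :
    Ideal (PowerSeries (MvPolynomial (Fin N) k)) :=
  Ideal.span { x | ∃ (D : Fin r → Derivation (PowerSeries k)
      (PowerSeries (MvPolynomial (Fin N) k)) (PowerSeries (MvPolynomial (Fin N) k)))
      (f : Fin r → PowerSeries (MvPolynomial (Fin N) k)),
    (∀ j, f j ∈ P) ∧ x = Matrix.det (Matrix.of fun i j => D i (f j)) }

open scoped Polynomial

/-- Applying a derivation of `k[x₁,…,x_N]` coefficientwise. -/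
noncomputable def coeffDerivation {k : Type*} [CommRing k] {N : ℕ}
    (d : Derivation k (MvPolynomial (Fin N) k) (MvPolynomial (Fin N) k)) :
    Derivation (PowerSeries k) (PowerSeries (MvPolynomial (Fin N) k))
      (PowerSeries (MvPolynomial (Fin N) k)) :=
  Derivation.mk'
    { toFun := fun f => PowerSeries.mk fun n => d (PowerSeries.coeff n f)
      map_add' := fun f g => by ext1 n; simp
      map_smul' := fun a f => by
        ext1 n
        simp [Algebra.smul_def, RingHom.algebraMap_toAlgebra, PowerSeries.coeff_mul] }
    fun f g => by
      ext1 n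
      simp only [LinearMap.coe_mk, AddHom.coe_mk, PowerSeries.coeff_mk, PowerSeries.coeff_mul,
        map_sum, Derivation.leibniz, smul_eq_mul, map_add, Finset.sum_add_distrib]
      congr 1
      rw [← Finset.Nat.sum_antidiagonal_swap]
      rfl

lemma coeff_coeffDerivation {k : Type*} [CommRing k] {N : ℕ}
    (d : Derivation k (MvPolynomial (Fin N) k) (MvPolynomial (Fin N) k))
    (f : PowerSeries (MvPolynomial (Fin N) k)) (n : ℕ) :
    PowerSeries.coeff n (coeffDerivation d f) = d (PowerSeries.coeff n f) := by
  simp [coeffDerivation]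

lemma coeffDerivation_C {k : Type*} [CommRing k] {N : ℕ}
    (d : Derivation k (MvPolynomial (Fin N) k) (MvPolynomial (Fin N) k))
    (a : MvPolynomial (Fin N) k) :
    coeffDerivation d (PowerSeries.C a) = PowerSeries.C (d a) := by
  ext1 n
  rw [coeff_coeffDerivation, PowerSeries.coeff_C, PowerSeries.coeff_C]
  split_ifs <;> simp

lemma MvPolynomial.pderiv_aeval {k : Type*} [CommRing k] {s N : ℕ}
    (Y : Fin s → MvPolynomial (Fin N) k) (i : Fin N) (b : MvPolynomial (Fin s) k) :
    pderiv i (aeval Y b) = ∑ j, aeval Y (pderiv j b) * pderiv i (Y j) := by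
  induction b using MvPolynomial.induction_on with
  | C a => simp
  | add p q hp hq =>
    rw [map_add, map_add, hp, hq, ← Finset.sum_add_distrib]
    exact Finset.sum_congr rfl fun j _ => by rw [map_add, map_add, add_mul]
  | mul_X p l hp =>
    simp only [map_mul, aeval_X, Derivation.leibniz, hp, smul_eq_mul, map_add, add_mul,
      Finset.sum_add_distrib, pderiv_X, Finset.mul_sum]
    congr 1
    · rw [Finset.sum_eq_single l]
      · simp
      · intro j _ hj; simp [hj.symm]
      · simp
    · exact Finset.sum_congr rfl fun j _ => by ring

/-- The chain rule for a coefficientwise substitution of polynomials. -/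
lemma coeffDerivation_map_aeval {k : Type*} [CommRing k] {s N : ℕ}
    (Y : Fin s → MvPolynomial (Fin N) k) (i : Fin N)
    (b : PowerSeries (MvPolynomial (Fin s) k)) :
    coeffDerivation (MvPolynomial.pderiv i)
      (PowerSeries.map (MvPolynomial.aeval (R := k) Y).toRingHom b) =
      ∑ j, PowerSeries.map (MvPolynomial.aeval (R := k) Y).toRingHom
        (coeffDerivation (MvPolynomial.pderiv j) b) *
        PowerSeries.C (MvPolynomial.pderiv i (Y j)) := by
  ext1 n
  rw [coeff_coeffDerivation, PowerSeries.coeff_map, map_sum]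
  refine (MvPolynomial.pderiv_aeval Y i _).trans (Finset.sum_congr rfl fun j _ => ?_)
  rw [PowerSeries.coeff_mul_C, PowerSeries.coeff_map, coeff_coeffDerivation]
  rfl

/-- A derivation vanishing on `P` kills every element `c` with `p(c) ∈ P`, for a polynomial `p` of
nonzero reduction modulo `P` whose coefficients are killed by the derivation. -/
lemma Derivation.eq_zero_of_eval_mem {R L : Type*} [CommRing R] [Algebra ℚ R] [Field L]
    [Algebra R L] {P : Ideal R} [P.IsPrime] (hL : RingHom.ker (algebraMap R L) = P)
    (D : Derivation ℤ R L) (hD : ∀ f ∈ P, D f = 0) (c : R) (n : ℕ) (p : R[X]) (hn : p.natDegree ≤ n)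
    (hp : p.coeff n ∉ P) (hDp : ∀ i, D (p.coeff i) = 0) (hc : p.eval c ∈ P) : D c = 0 := by
  induction n generalizing p with
  | zero =>
    rw [Polynomial.eq_C_of_natDegree_le_zero hn, Polynomial.eval_C] at hc
    exact absurd hc hp
  | succ n ih =>
    have key : D (p.eval c) = algebraMap R L (p.derivative.eval c) * D c := by
      rw [Polynomial.eval_eq_sum_range, map_sum, Polynomial.derivative_eval,
        Polynomial.sum_over_range _ (by simp), map_sum, Finset.sum_mul]
      refine Finset.sum_congr rfl fun i _ => ?_
      rw [Derivation.leibniz, hDp, smul_zero, add_zero, Derivation.leibniz_pow]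
      simp [Algebra.smul_def]
      ring
    rw [hD _ hc, eq_comm, mul_eq_zero] at key
    rcases key with h | h
    · have h' : p.derivative.eval c ∈ P := by rw [← hL]; exact h
      refine ih p.derivative ?_ ?_ ?_ h'
      · exact (Polynomial.natDegree_derivative_le p).trans (by omega)
      · rw [Polynomial.coeff_derivative]
        intro hmem
        rcases ‹P.IsPrime›.mem_or_mem hmem with h1 | h1
        · exact hp h1
        · refine ‹P.IsPrime›.ne_top (Ideal.eq_top_of_isUnit_mem _ h1 ?_)
          have : ((n : R) + 1) = algebraMap ℚ R ((n : ℚ) + 1) := by simp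
          rw [this]
          exact (IsUnit.mk0 _ (by positivity)).map _
      · intro i
        rw [Polynomial.coeff_derivative, Derivation.leibniz, hDp]
        have : D ((i : R) + 1) = 0 := by simp
        rw [this]; simp
    · exact h

/-- The variant of `Derivation.eq_zero_of_eval_mem` for additive maps with the Leibniz rule. -/
lemma eq_zero_of_eval_mem_of_leibniz {R L : Type*} [CommRing R] [Algebra ℚ R] [Field L]
    [Algebra R L] {P : Ideal R} [P.IsPrime] (hL : RingHom.ker (algebraMap R L) = P) (D : R →+ L)
    (hmul : ∀ f g, D (f * g) = algebraMap R L f * D g + algebraMap R L g * D f)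
    (hD : ∀ f ∈ P, D f = 0) (c : R) (n : ℕ) (p : R[X]) (hn : p.natDegree ≤ n)
    (hp : p.coeff n ∉ P) (hDp : ∀ i, D (p.coeff i) = 0) (hc : p.eval c ∈ P) : D c = 0 :=
  (Derivation.mk' D.toIntLinearMap fun f g => by
    simpa [Algebra.smul_def] using hmul f g).eq_zero_of_eval_mem hL hD c n p hn hp hDp hc

lemma Order.exists_lt_natCast_le_height {α : Type*} [Preorder α] {a : α} {n : ℕ}
    (h : ((n + 1 : ℕ) : ℕ∞) ≤ Order.height a) : ∃ b < a, (n : ℕ∞) ≤ Order.height b := by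
  obtain ⟨l, hl, hn⟩ := Order.exists_series_of_le_height a h
  refine ⟨l ⟨n, by omega⟩, ?_, ?_⟩
  · rw [← hl]
    exact l.strictMono (by simp [Fin.lt_def, hn])
  · exact Order.index_le_height l ⟨n, by omega⟩

lemma Ideal.ht_eq_height_s18 {R : Type*} [CommRing R] (P : Ideal R) [hP : P.IsPrime] :
    P.ht = Order.height (⟨P, hP⟩ : PrimeSpectrum R) :=
  le_antisymm (iInf₂_le (⟨P, hP⟩ : PrimeSpectrum R) le_rfl)
    (le_iInf₂ fun _ hQ => Order.height_mono hQ)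

/-- Heights lift along integral extensions. -/
lemma PrimeSpectrum.exists_comap_eq_natCast_le_height {R S : Type*} [CommRing R] [CommRing S]
    (g : R →+* S) (hg : g.IsIntegral) (hinj : Function.Injective g) (n : ℕ)
    (p : PrimeSpectrum R) (hp : (n : ℕ∞) ≤ Order.height p) :
    ∃ q : PrimeSpectrum S, comap g q = p ∧ (n : ℕ∞) ≤ Order.height q := by
  let _ := g.toAlgebra
  have : Algebra.IsIntegral R S := ⟨hg⟩
  induction n generalizing p with
  | zero =>
    obtain ⟨Q, -, hQ, hc⟩ := Ideal.exists_ideal_over_prime_of_isIntegral p.asIdeal (⊥ : Ideal S)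
      (by rw [← RingHom.ker_eq_comap_bot]
          exact ((RingHom.injective_iff_ker_eq_bot g).mp hinj).trans_le bot_le)
    exact ⟨⟨Q, hQ⟩, PrimeSpectrum.ext hc, by simp⟩
  | succ n ih =>
    obtain ⟨p', hlt, hn⟩ := Order.exists_lt_natCast_le_height hp
    obtain ⟨q', hq', hn'⟩ := ih p' hn
    obtain ⟨Q, hle, hQ, hc⟩ := Ideal.exists_ideal_over_prime_of_isIntegral p.asIdeal q'.asIdeal
      (by rw [← hq'] at hlt; exact hlt.le)
    refine ⟨⟨Q, hQ⟩, PrimeSpectrum.ext hc, ?_⟩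
    have hlt' : q' < ⟨Q, hQ⟩ := by
      refine lt_of_le_of_ne hle fun h => hlt.ne ?_
      rw [← hq', h]
      exact PrimeSpectrum.ext hc
    push_cast
    exact (add_le_add_left hn' 1).trans (Order.height_add_one_le hlt')

/-- A prime strictly below the kernel of a surjection contributes its height to the
heights of all contracted primes. -/
lemma PrimeSpectrum.natCast_add_height_le_height_comap {R S : Type*} [CommRing R] [CommRing S]
    (f : R →+* S) (hf : Function.Surjective f) (p : PrimeSpectrum R)
    (hp : p.asIdeal < RingHom.ker f) (n : ℕ) (q : PrimeSpectrum S)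
    (hq : (n : ℕ∞) ≤ Order.height q) :
    Order.height p + 1 + n ≤ Order.height (comap f q) := by
  induction n generalizing q with
  | zero =>
    simp only [Nat.cast_zero, add_zero]
    exact Order.height_add_one_le (hp.trans_le (Ideal.ker_le_comap f))
  | succ n ih =>
    obtain ⟨q', hlt, hn⟩ := Order.exists_lt_natCast_le_height hq
    push_cast
    rw [← add_assoc]
    refine (add_le_add_left (ih q' hn) 1).trans (Order.height_add_one_le ?_)
    refine lt_of_le_of_ne (Ideal.comap_mono hlt.le) fun h => hlt.ne ?_
    exact PrimeSpectrum.comap_injective_of_surjective f hf h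

lemma PowerSeries.X_mem_jacobson {R : Type*} [CommRing R] :
    (PowerSeries.X : PowerSeries R) ∈ Ring.jacobson (PowerSeries R) := by
  rw [Ring.jacobson_eq_sInf_isMaximal, Submodule.mem_sInf]
  intro M hM
  by_contra hX
  obtain ⟨a, b, hb, h⟩ := hM.exists_inv hX
  refine hM.ne_top (Ideal.eq_top_of_isUnit_mem _ hb (PowerSeries.isUnit_iff_constantCoeff.mpr ?_))
  have := congrArg PowerSeries.constantCoeff h
  simp only [map_add, map_mul, PowerSeries.constantCoeff_X, mul_zero, zero_add, map_one] at this
  rw [this]; exact isUnit_one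

lemma PowerSeries.ringKrullDim_le {R : Type*} [CommRing R] [IsNoetherianRing R] :
    ringKrullDim (PowerSeries R) ≤ ringKrullDim R + 1 := by
  have h := ringKrullDim_le_ringKrullDim_quotient_add_card (R := PowerSeries R)
    {PowerSeries.X} (by simpa using PowerSeries.X_mem_jacobson)
  rw [Finset.coe_singleton, Finset.card_singleton, Nat.cast_one] at h
  refine h.trans (add_le_add_left (ringKrullDim_le_of_surjective
    ((Ideal.Quotient.mk (Ideal.span {(PowerSeries.X : PowerSeries R)})).comp PowerSeries.C) ?_) 1)
  intro y
  obtain ⟨f, rfl⟩ := Ideal.Quotient.mk_surjective y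
  refine ⟨PowerSeries.constantCoeff f, ?_⟩
  rw [RingHom.comp_apply, Ideal.Quotient.eq, Ideal.mem_span_singleton, PowerSeries.X_dvd_iff]
  simp

lemma PowerSeries.map_constantCoeff_ne_top {R : Type*} [CommRing R] {P : Ideal (PowerSeries R)}
    (hP : P ≠ ⊤) : P.map (PowerSeries.constantCoeff (R := R)) ≠ ⊤ := by
  intro h
  rw [Ideal.eq_top_iff_one, Ideal.mem_map_iff_of_surjective _
    PowerSeries.constantCoeff_surj] at h
  obtain ⟨f, hf, h1⟩ := h
  exact hP (Ideal.eq_top_of_isUnit_mem _ hf (PowerSeries.isUnit_iff_constantCoeff.mpr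
    (h1 ▸ isUnit_one)))

/-- If `k[x₁,…,x_N][[t]]` modulo `(P, t)` is integral over a polynomial ring in `s` variables and
`t ∉ P`, then `P` has height at most `N - s`. -/
lemma PowerSeries.ht_add_le {k : Type*} [Field k] {N s : ℕ}
    (P : Ideal (PowerSeries (MvPolynomial (Fin N) k))) [hP : P.IsPrime]
    (hX : (PowerSeries.X : PowerSeries (MvPolynomial (Fin N) k)) ∉ P)
    (g : MvPolynomial (Fin s) k →+* MvPolynomial (Fin N) k ⧸ P.map PowerSeries.constantCoeff)
    (hg : g.IsIntegral) (hinj : Function.Injective g) :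
    P.ht + s ≤ N := by
  have hs : ringKrullDim (MvPolynomial (Fin s) k) = s := by simp
  have hN : ringKrullDim (MvPolynomial (Fin N) k) = N := by simp
  obtain ⟨l, hl⟩ := (Order.le_krullDim_iff (n := s)).mp hs.ge
  obtain ⟨q, -, hq⟩ := PrimeSpectrum.exists_comap_eq_natCast_le_height g hg hinj s l.last
    ((congrArg Nat.cast hl.symm).trans_le Order.length_le_height_last)
  let f : PowerSeries (MvPolynomial (Fin N) k) →+* _ :=
    (Ideal.Quotient.mk (P.map PowerSeries.constantCoeff)).comp PowerSeries.constantCoeff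
  have hf : Function.Surjective f :=
    Ideal.Quotient.mk_surjective.comp PowerSeries.constantCoeff_surj
  have hlt : P < RingHom.ker f := by
    refine SetLike.lt_iff_le_and_exists.mpr ⟨fun x hx => ?_, PowerSeries.X, ?_, hX⟩
    · exact Ideal.Quotient.eq_zero_iff_mem.mpr (Ideal.mem_map_of_mem _ hx)
    · simp [f, RingHom.mem_ker]
  have h1 := PrimeSpectrum.natCast_add_height_le_height_comap f hf ⟨P, hP⟩ hlt s q hq
  have h2 := (WithBot.coe_le_coe.mpr h1).trans
    (Order.height_le_krullDim (PrimeSpectrum.comap f q))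
  have h3 := h2.trans (PowerSeries.ringKrullDim_le (R := MvPolynomial (Fin N) k))
  rw [hN, ← Ideal.ht_eq_height_s18] at h3
  have h4 : P.ht + 1 + s ≤ (N : ℕ∞) + 1 := by exact_mod_cast h3
  have h5 : P.ht + s + 1 ≤ (N : ℕ∞) + 1 := by rwa [add_right_comm]
  exact (ENat.add_le_add_iff_right (by simp)).mp h5

/-- If `A` modulo the constant coefficients of `P` is spanned over `B` by the `e j`, then
`A⟦X⟧` modulo `P` is spanned over `B⟦X⟧` by the `C (e j)`. -/
lemma PowerSeries.exists_sub_sum_mem {A B ι : Type*} [CommRing A] [CommRing B] [Fintype ι]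
    [IsNoetherianRing A] (P : Ideal (PowerSeries A)) (φ : B →+* A) (e : ι → A)
    (he : ∀ a : A, ∃ b : ι → B, a - ∑ j, φ (b j) * e j ∈ P.map constantCoeff)
    (f : PowerSeries A) :
    ∃ b : ι → PowerSeries B, f - ∑ j, map φ (b j) * C (e j) ∈ P := by
  have step : ∀ f : PowerSeries A, ∃ (b : ι → B) (f' : PowerSeries A),
      f - ∑ j, C (φ (b j)) * C (e j) - X * f' ∈ P := by
    intro f
    obtain ⟨b, hb⟩ := he (constantCoeff f)
    obtain ⟨p, hp, hpe⟩ := (Ideal.mem_map_iff_of_surjective _ constantCoeff_surj).mp hb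
    have hX : X ∣ f - ∑ j, C (φ (b j)) * C (e j) - p := by
      rw [X_dvd_iff]
      simp [hpe]
    obtain ⟨f', hf'⟩ := hX
    exact ⟨b, f', by rw [← hf']; simpa using hp⟩
  choose β σ hβ using step
  let F : ℕ → PowerSeries A := fun n => σ^[n] f
  have hF : ∀ n, F (n + 1) = σ (F n) := fun n => Function.iterate_succ_apply' σ n f
  let S : ℕ → ι → PowerSeries B := fun n j => mk fun m => β (F (n + m)) j
  let G : ℕ → PowerSeries A := fun n => F n - ∑ j, map φ (S n j) * C (e j)
  have hS : ∀ n j, S n j = X * S (n + 1) j + C (β (F n) j) := by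
    intro n j
    rw [eq_X_mul_shift_add_const (S n j)]
    congr 2
    ext m
    simp [S, add_comm, add_left_comm]
  have hG : ∀ n, G n - X * G (n + 1) ∈ P := by
    intro n
    have : G n - X * G (n + 1) =
        F n - ∑ j, C (φ (β (F n) j)) * C (e j) - X * σ (F n) := by
      simp only [G, hF, hS n, map_add, map_mul, map_X, map_C, add_mul, Finset.sum_add_distrib,
        mul_sub, Finset.mul_sum, mul_assoc]
      ring
    rw [this]
    exact hβ _
  have hG0 : ∀ n, G 0 - X ^ n * G n ∈ P := by
    intro n
    induction n with
    | zero => simp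
    | succ n ih =>
      have := P.add_mem ih (P.mul_mem_left (X ^ n) (hG n))
      convert this using 1
      ring
  refine ⟨S 0, ?_⟩
  have haus : IsHausdorff (Ideal.span {(X : PowerSeries A)}) (PowerSeries A ⧸ P) := by
    refine .of_le_jacobson _ _ ?_
    rw [Ideal.span_singleton_le_iff_mem, Ideal.jacobson_bot]
    exact X_mem_jacobson
  refine Ideal.Quotient.eq_zero_iff_mem.mp (haus.haus (Ideal.Quotient.mk P (G 0)) fun n => ?_)
  rw [SModEq.zero, Ideal.Quotient.eq.mpr (hG0 n), Ideal.span_singleton_pow]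
  have : Ideal.Quotient.mk P (X ^ n * G n) = (X ^ n : PowerSeries A) • Ideal.Quotient.mk P (G n) :=
    rfl
  rw [this]
  exact Submodule.smul_mem_smul (Ideal.mem_span_singleton_self _) trivial

/-- Integrality of `A⟦X⟧ ⧸ P` over `B⟦X⟧`, given finiteness modulo `X`. -/
lemma PowerSeries.exists_monic_eval₂_mem {A B : Type*} [CommRing A] [CommRing B]
    [IsNoetherianRing A] (P : Ideal (PowerSeries A)) (φ : B →+* A)
    (hφ : ((Ideal.Quotient.mk (P.map constantCoeff)).comp φ).Finite) (f : PowerSeries A) :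
    ∃ p : (PowerSeries B)[X], p.Monic ∧ p.eval₂ (map φ) f ∈ P := by
  obtain ⟨m, e, he⟩ : ∃ (m : ℕ) (e : Fin m → A),
      ∀ a : A, ∃ b : Fin m → B, a - ∑ j, φ (b j) * e j ∈ P.map constantCoeff := by
    let _ := ((Ideal.Quotient.mk (P.map constantCoeff)).comp φ).toAlgebra
    have : Module.Finite B (A ⧸ P.map constantCoeff) := hφ
    obtain ⟨m, e', he'⟩ := Module.Finite.exists_fin (R := B) (M := A ⧸ P.map constantCoeff)
    choose e he using fun j => Ideal.Quotient.mk_surjective (e' j)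
    refine ⟨m, e, fun a => ?_⟩
    have ha : Ideal.Quotient.mk _ a ∈ Submodule.span B (Set.range e') := he' ▸ trivial
    obtain ⟨b, hb⟩ := (Submodule.mem_span_range_iff_exists_fun B).mp ha
    refine ⟨b, Ideal.Quotient.eq.mp ?_⟩
    rw [← hb, map_sum]
    exact Finset.sum_congr rfl fun j _ => by rw [← he, Algebra.smul_def, map_mul]; rfl
  let ψ : PowerSeries B →+* PowerSeries A ⧸ P := (Ideal.Quotient.mk P).comp (map φ)
  let _ := ψ.toAlgebra
  have hfin : Module.Finite (PowerSeries B) (PowerSeries A ⧸ P) := by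
    refine Module.Finite.of_surjective
      (Fintype.linearCombination (PowerSeries B) fun j => Ideal.Quotient.mk P (C (e j))) ?_
    intro y
    obtain ⟨f, rfl⟩ := Ideal.Quotient.mk_surjective y
    obtain ⟨b, hb⟩ := exists_sub_sum_mem P φ e he f
    refine ⟨b, ?_⟩
    rw [Ideal.Quotient.eq.mpr hb, map_sum, Fintype.linearCombination_apply]
    exact Finset.sum_congr rfl fun j _ => by rw [Algebra.smul_def, map_mul]; rfl
  obtain ⟨p, hp, h⟩ := Algebra.IsIntegral.isIntegral (R := PowerSeries B) (Ideal.Quotient.mk P f)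
  refine ⟨p, hp, Ideal.Quotient.eq_zero_iff_mem.mp ?_⟩
  rw [Polynomial.hom_eval₂]
  exact h
/-- Derivations act compatibly with finite sums. -/
lemma Derivation.sum_apply {A R M ι : Type*} [CommSemiring A] [CommSemiring R] [Algebra A R]
    [AddCommMonoid M] [Module R M] [Module A M] (s : Finset ι) (D : ι → Derivation A R M) (x : R) :
    (∑ i ∈ s, D i) x = ∑ i ∈ s, D i x := by
  classical
  induction s using Finset.induction_on with
  | empty => simp
  | insert i s hi ih => rw [Finset.sum_insert hi, Finset.sum_insert hi, Derivation.add_apply, ih]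

/-- The gradient of `f` with respect to `x₁,…,x_N`, evaluated in the residue field of `P`. -/
noncomputable def residueGradient {k : Type*} [CommRing k] {N : ℕ}
    (P : Ideal (PowerSeries (MvPolynomial (Fin N) k))) [P.IsPrime] :
    PowerSeries (MvPolynomial (Fin N) k) →+ (Fin N → P.ResidueField) where
  toFun f i := algebraMap _ P.ResidueField (coeffDerivation (MvPolynomial.pderiv i) f)
  map_zero' := by ext i; simp
  map_add' f g := by ext i; simp

lemma residueGradient_apply {k : Type*} [CommRing k] {N : ℕ}
    (P : Ideal (PowerSeries (MvPolynomial (Fin N) k))) [P.IsPrime]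
    (f : PowerSeries (MvPolynomial (Fin N) k)) (i : Fin N) :
    residueGradient P f i =
      algebraMap _ P.ResidueField (coeffDerivation (MvPolynomial.pderiv i) f) :=
  rfl

lemma residueGradient_mul {k : Type*} [CommRing k] {N : ℕ}
    (P : Ideal (PowerSeries (MvPolynomial (Fin N) k))) [P.IsPrime]
    (f g : PowerSeries (MvPolynomial (Fin N) k)) :
    residueGradient P (f * g) = algebraMap _ P.ResidueField f • residueGradient P g +
      algebraMap _ P.ResidueField g • residueGradient P f := by
  ext i
  simp only [residueGradient_apply, Derivation.leibniz, Pi.add_apply, Pi.smul_apply, smul_eq_mul,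
    map_add, map_mul]

/-- The Jacobian matrix of `P` has rank at least the height of `P`. -/
lemma le_finrank_span_residueGradient {k : Type*} [Field k] [CharZero k] {N : ℕ}
    (P : Ideal (PowerSeries (MvPolynomial (Fin N) k))) [hP : P.IsPrime]
    (hX : (PowerSeries.X : PowerSeries (MvPolynomial (Fin N) k)) ∉ P) :
    P.ht ≤ Module.finrank P.ResidueField
      (Submodule.span P.ResidueField (residueGradient P '' P)) := by
  have hne := PowerSeries.map_constantCoeff_ne_top hP.ne_top
  have := Ideal.Quotient.nontrivial_iff.mpr hne
  obtain ⟨s, g, hinj, hfin⟩ := exists_finite_inj_algHom_of_fg k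
    (MvPolynomial (Fin N) k ⧸ P.map PowerSeries.constantCoeff)
  have hle := PowerSeries.ht_add_le P hX g.toRingHom hfin.to_isIntegral hinj
  choose Y hY using fun j => Ideal.Quotient.mk_surjective (g (MvPolynomial.X j))
  have hgY : (Ideal.Quotient.mk (P.map PowerSeries.constantCoeff)).comp
      (MvPolynomial.aeval (R := k) Y).toRingHom = g.toRingHom := by
    have : (Ideal.Quotient.mkₐ k (P.map PowerSeries.constantCoeff)).comp
        (MvPolynomial.aeval (R := k) Y) = g := by
      ext j
      simp [hY]
    exact congrArg AlgHom.toRingHom this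
  let W := Submodule.span P.ResidueField (residueGradient P '' P)
  let U := Submodule.span P.ResidueField
    (Set.range fun j => residueGradient P (PowerSeries.C (Y j)))
  have htop : W ⊔ U = ⊤ := by
    by_contra hlt
    obtain ⟨ℓ, hℓ, hker⟩ := Submodule.exists_le_ker_of_lt_top _ (lt_top_iff_ne_top.mpr hlt)
    let D : PowerSeries (MvPolynomial (Fin N) k) →+ P.ResidueField :=
      ℓ.toAddMonoidHom.comp (residueGradient P)
    have hD : ∀ f, D f = ℓ (residueGradient P f) := fun f => rfl
    have hDmul : ∀ f g, D (f * g) = algebraMap _ P.ResidueField f * D g +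
        algebraMap _ P.ResidueField g * D f := fun f g => by
      simp only [hD, residueGradient_mul, map_add, map_smul, smul_eq_mul]
    have hDP : ∀ f ∈ P, D f = 0 := fun f hf => by
      rw [hD]
      exact hker (Submodule.mem_sup_left (Submodule.subset_span ⟨f, hf, rfl⟩))
    have hDY : ∀ j, D (PowerSeries.C (Y j)) = 0 := fun j => by
      rw [hD]
      exact hker (Submodule.mem_sup_right (Submodule.subset_span ⟨j, rfl⟩))
    have hDB : ∀ b : PowerSeries (MvPolynomial (Fin s) k),
        D (PowerSeries.map (MvPolynomial.aeval (R := k) Y).toRingHom b) = 0 := by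
      intro b
      have : ∀ i, residueGradient P
          (PowerSeries.map (MvPolynomial.aeval (R := k) Y).toRingHom b) i =
          ∑ j, algebraMap _ P.ResidueField (PowerSeries.map
            (MvPolynomial.aeval (R := k) Y).toRingHom
              (coeffDerivation (MvPolynomial.pderiv j) b)) *
            residueGradient P (PowerSeries.C (Y j)) i := by
        intro i
        simp only [residueGradient_apply, coeffDerivation_map_aeval, coeffDerivation_C, map_sum,
          map_mul]
      have hsum : residueGradient P
          (PowerSeries.map (MvPolynomial.aeval (R := k) Y).toRingHom b) =
          ∑ j, algebraMap _ P.ResidueField (PowerSeries.map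
            (MvPolynomial.aeval (R := k) Y).toRingHom
              (coeffDerivation (MvPolynomial.pderiv j) b)) •
            residueGradient P (PowerSeries.C (Y j)) := by
        ext i
        rw [this, Finset.sum_apply]
        rfl
      rw [hD, hsum, map_sum]
      exact Finset.sum_eq_zero fun j _ => by rw [map_smul, ← hD, hDY, smul_zero]
    have hDC : ∀ c, D c = 0 := by
      intro c
      obtain ⟨p, hp, hpc⟩ := PowerSeries.exists_monic_eval₂_mem P
        (MvPolynomial.aeval (R := k) Y).toRingHom (hgY ▸ hfin) c
      let _ : Algebra ℚ (PowerSeries (MvPolynomial (Fin N) k)) :=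
        (PowerSeries.C.comp (MvPolynomial.C.comp (algebraMap ℚ k))).toAlgebra
      refine eq_zero_of_eval_mem_of_leibniz P.ker_algebraMap_residueField D hDmul hDP c p.natDegree
        (p.map (PowerSeries.map (MvPolynomial.aeval (R := k) Y).toRingHom))
        Polynomial.natDegree_map_le ?_ ?_ ?_
      · rw [Polynomial.coeff_map, hp.coeff_natDegree, map_one]
        exact fun h => hP.ne_top ((Ideal.eq_top_iff_one P).mpr h)
      · intro i
        rw [Polynomial.coeff_map]
        exact hDB _
      · rwa [Polynomial.eval_map]
    refine hℓ (LinearMap.pi_ext' fun i => LinearMap.ext_ring ?_)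
    have := hDC (PowerSeries.C (MvPolynomial.X i))
    rw [hD] at this
    rw [LinearMap.zero_comp, LinearMap.zero_apply, LinearMap.comp_apply, ← this]
    congr 1
    ext j
    simp [residueGradient_apply, coeffDerivation_C, MvPolynomial.pderiv_X, Pi.single_apply, eq_comm,
      apply_ite]
  have hdim : N ≤ Module.finrank P.ResidueField W + s := by
    have h1 := Submodule.finrank_add_le_finrank_add_finrank W U
    rw [htop, finrank_top, Module.finrank_fin_fun] at h1
    have h2 : Module.finrank P.ResidueField U ≤ s := by
      exact (finrank_range_le_card (R := P.ResidueField)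
        (fun j => residueGradient P (PowerSeries.C (Y j)))).trans_eq (Fintype.card_fin s)
    omega
  have : P.ht + s ≤ (Module.finrank P.ResidueField W : ℕ∞) + s :=
    hle.trans (by exact_mod_cast hdim)
  exact (ENat.add_le_add_iff_right (by simp)).mp this

/-- Linearly independent vectors over the fraction field of `R ⧸ P` admit, up to a common
nonzero denominator, dual vectors with entries in `R`. -/
lemma LinearIndependent.exists_dual_lift {R ι κ : Type*} [CommRing R] [Fintype ι] [DecidableEq ι]
    [Fintype κ]
    (P : Ideal R) [P.IsPrime] {w : ι → κ → P.ResidueField}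
    (hw : LinearIndependent P.ResidueField w) :
    ∃ (c : ι → κ → R) (z : P.ResidueField), z ≠ 0 ∧ ∀ i j,
      ∑ a, algebraMap R P.ResidueField (c i a) * w j a = if i = j then z else 0 := by
  classical
  obtain ⟨ℓ, hℓ⟩ := LinearMap.exists_leftInverse_of_injective
    (Fintype.linearCombination P.ResidueField w)
    (LinearMap.ker_eq_bot.mpr hw.fintypeLinearCombination_injective)
  obtain ⟨z, hz⟩ := IsLocalization.exist_integer_multiples_of_finite (nonZeroDivisors (R ⧸ P))
    fun x : ι × κ => ℓ (Pi.single x.2 1) x.1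
  choose c' hc' using hz
  choose c hc using fun x => Ideal.Quotient.mk_surjective (c' x)
  have hcz : ∀ i a, algebraMap R P.ResidueField (c (i, a)) =
      algebraMap (R ⧸ P) P.ResidueField z * ℓ (Pi.single a 1) i := by
    intro i a
    rw [← Ideal.algebraMap_quotient_residueField_mk, hc, hc', Algebra.smul_def]
  refine ⟨fun i a => c (i, a), algebraMap (R ⧸ P) P.ResidueField z, ?_, fun i j => ?_⟩
  · exact IsFractionRing.to_map_ne_zero_of_mem_nonZeroDivisors z.2
  · have h1 : ℓ (w j) = Pi.single j 1 := by
      have := LinearMap.congr_fun hℓ (Pi.single j 1)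
      simpa using this
    have h2 : ℓ (w j) i = ∑ a, ℓ (Pi.single a 1) i * w j a := by
      conv_lhs => rw [← Finset.univ_sum_single (w j)]
      rw [map_sum, Finset.sum_apply]
      refine Finset.sum_congr rfl fun a _ => ?_
      have : Pi.single (M := fun _ => P.ResidueField) a (w j a) =
          w j a • Pi.single a (1 : P.ResidueField) := by
        rw [← Pi.single_smul, smul_eq_mul, mul_one]
      rw [this, map_smul, Pi.smul_apply, smul_eq_mul, mul_comm]
    simp only [hcz, mul_assoc, ← Finset.mul_sum, ← h2, h1, Pi.single_apply]
    simp

/-- Let `S₁ = k[x₁,…,x_N][[t]]` over a field `k` of characteristic zero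
and let `P` be a prime ideal of height `r` with `t ∉ P` (equivalently `P ∩ k[[t]] = 0`).
Then `𝒥_r(P; Der_{k[[t]]}(S₁))` is not contained in `P`. -/
theorem derJacobianIdeal_not_le_prime
    {k : Type*} [Field k] [CharZero k] {N r : ℕ}
    (P : Ideal (PowerSeries (MvPolynomial (Fin N) k))) [P.IsPrime]
    (hht : P.ht = r)
    (ht' : (PowerSeries.X : PowerSeries (MvPolynomial (Fin N) k)) ∉ P) :
    ¬ derJacobianIdeal r P ≤ P := by
  intro hle
  have hr := le_finrank_span_residueGradient P ht'
  rw [hht, Nat.cast_le] at hr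
  obtain ⟨w, hwP, -, hw⟩ := Submodule.exists_fun_fin_finrank_span_eq P.ResidueField
    (residueGradient P '' P)
  choose f hfP hf using fun i : Fin r => hwP (Fin.castLE hr i)
  have hw' : LinearIndependent P.ResidueField fun i : Fin r => residueGradient P (f i) := by
    simp only [hf]
    exact hw.comp _ (Fin.castLE_injective hr)
  obtain ⟨c, z, hz, hc⟩ := hw'.exists_dual_lift
  have hmem : Matrix.det (Matrix.of fun i j =>
      (∑ a, c i a • coeffDerivation (MvPolynomial.pderiv a)) (f j)) ∈ P :=
    hle (Ideal.subset_span
      ⟨fun i => ∑ a, c i a • coeffDerivation (MvPolynomial.pderiv a), f, hfP, rfl⟩)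
  rw [← Ideal.algebraMap_residueField_eq_zero, RingHom.map_det] at hmem
  refine pow_ne_zero r hz ?_
  rw [← hmem]
  have : (algebraMap _ P.ResidueField).mapMatrix (Matrix.of fun i j =>
      (∑ a, c i a • coeffDerivation (MvPolynomial.pderiv a)) (f j)) =
      Matrix.diagonal fun _ : Fin r => z := by
    ext i j
    rw [Matrix.diagonal_apply, ← hc i j, RingHom.mapMatrix_apply, Matrix.map_apply,
      Matrix.of_apply, Derivation.sum_apply, map_sum]
    exact Finset.sum_congr rfl fun a _ => map_mul _ _ _
  rw [this, Matrix.det_diagonal]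
  simp
end
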